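/- arXiv:0705.1961 — 3 statements merged into one kernel-verified Lean document; each statement's English description precedes it below -/
import Mathlib

section
/- Let (𝔄,(A_i)_{i∈𝓛}) and (𝔅,(B_i)_{i∈𝓛}) be 𝓛-graded C*-algebras and ρ : 𝔄 → 𝔅 a *-homomorphism with ρ(A_i) ⊆ B_i for all i ∈ 𝓛 (a morphism of graded C*-algebras); write ρ_i : A_i → B_i for its restriction. Then ρ is surjective if and only if ρ_i is surjective (i.e. ρ(A_i) = B_i) for every i ∈ 𝓛, and ρ is injective if and only if ρ_i is injective for every i ∈ 𝓛. -/
section CStarLift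

open scoped CStarAlgebra

variable {𝔄 𝔅 : Type*} [NonUnitalCStarAlgebra 𝔄] [NonUnitalCStarAlgebra 𝔅]

/-- A self-adjoint element of the range of a *-homomorphism of C⋆-algebras lifts without
increasing the norm. -/
theorem NonUnitalStarAlgHom.exists_norm_le_of_isSelfAdjoint (φ : 𝔄 →⋆ₙₐ[ℂ] 𝔅) {a : 𝔄}
    (ha : IsSelfAdjoint a) : ∃ a', φ a' = φ a ∧ ‖a'‖ ≤ ‖φ a‖ := by
  set r := ‖φ a‖
  have hr : 0 ≤ r := norm_nonneg _
  have hφ : Continuous φ := map_continuous φ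
  have hφa : IsSelfAdjoint (φ a) := ha.map φ
  let f : ℝ → ℝ := fun t ↦ max (-r) (min t r)
  have hf : Continuous f := by fun_prop
  have hf0 : f 0 = 0 := by simp [f, hr]
  refine ⟨cfcₙ f a, ?_, norm_cfcₙ_le fun t _ ↦ ?_⟩
  · rw [φ.map_cfcₙ f a hf.continuousOn hf0 hφ ha hφa]
    conv_rhs => rw [← cfcₙ_id ℝ (φ a)]
    refine cfcₙ_congr fun t ht ↦ ?_
    have h : ‖t‖ ≤ r := by
      have := norm_apply_le_norm_cfcₙ (id : ℝ → ℝ) (φ a) ht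
      rwa [cfcₙ_id ℝ (φ a)] at this
    obtain ⟨h1, h2⟩ := abs_le.mp h
    simp [f, h1, h2]
  · rw [Real.norm_eq_abs, abs_le]
    exact ⟨le_max_left _ _, max_le (by linarith) (min_le_right _ _)⟩

open ComplexStarModule in
theorem NonUnitalStarAlgHom.exists_norm_le_two_mul (φ : 𝔄 →⋆ₙₐ[ℂ] 𝔅) (a : 𝔄) :
    ∃ a', φ a' = φ a ∧ ‖a'‖ ≤ 2 * ‖φ a‖ := by
  have key (x : 𝔄) (hx : IsSelfAdjoint x) (h : ‖φ x‖ ≤ ‖φ a‖) :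
      ∃ x', φ x' = φ x ∧ ‖x'‖ ≤ ‖φ a‖ :=
    let ⟨x', h1, h2⟩ := φ.exists_norm_le_of_isSelfAdjoint hx
    ⟨x', h1, h2.trans h⟩
  obtain ⟨x, hx, hxn⟩ := key (realPart a) (realPart a).2
    (by rw [map_realPart φ a]; exact realPart.norm_le (φ a))
  obtain ⟨y, hy, hyn⟩ := key (imaginaryPart a) (imaginaryPart a).2
    (by rw [map_imaginaryPart φ a]; exact imaginaryPart.norm_le (φ a))
  refine ⟨x + Complex.I • y, ?_, ?_⟩
  · rw [map_add, map_smul, hx, hy, ← map_smul, ← map_add, realPart_add_I_smul_imaginaryPart]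
  · calc _ ≤ ‖x‖ + ‖Complex.I • y‖ := norm_add_le _ _
      _ ≤ _ := by rw [norm_smul, Complex.norm_I]; linarith

theorem NonUnitalStarAlgHom.isClosed_range_of_cstar (φ : 𝔄 →⋆ₙₐ[ℂ] 𝔅) :
    IsClosed (Set.range φ) := by
  let f : NormedAddGroupHom 𝔄 𝔅 :=
    ⟨φ, map_add φ, 1, fun a ↦ by simpa using NonUnitalStarAlgHom.norm_apply_le φ a⟩
  have h := controlled_closure_of_complete (f := f) (K := f.range) two_pos one_pos (by
    rintro _ ⟨a, rfl⟩
    exact φ.exists_norm_le_two_mul a)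
  refine isClosed_of_closure_subset fun y hy ↦ ?_
  obtain ⟨a, ha, -⟩ := h y hy
  exact ⟨a, ha⟩

/-- The pairs `(y, d)` with `d ∈ D` such that `y` and `ρ d` agree modulo `I`. -/
def NonUnitalStarAlgHom.graphMod (ρ : 𝔄 →⋆ₙₐ[ℂ] 𝔅) (D : NonUnitalStarSubalgebra ℂ 𝔄)
    (I : NonUnitalStarSubalgebra ℂ 𝔅) (h : ∀ d ∈ D, ∀ x ∈ I, ρ d * x ∈ I) :
    NonUnitalStarSubalgebra ℂ (𝔅 × 𝔄) where
  carrier := {p | p.2 ∈ D ∧ p.1 - ρ p.2 ∈ I}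
  add_mem' {p q} hp hq := ⟨add_mem hp.1 hq.1, by
    simpa [add_sub_add_comm] using add_mem hp.2 hq.2⟩
  zero_mem' := ⟨zero_mem D, by simp⟩
  mul_mem' {p q} hp hq := ⟨mul_mem hp.1 hq.1, by
    have h' : (p.1 - ρ p.2) * ρ q.2 ∈ I := by
      have := star_mem (h _ (star_mem hq.1) _ (star_mem hp.2))
      rwa [map_star, ← star_mul, star_star] at this
    have := add_mem (add_mem (mul_mem hp.2 hq.2) h') (h _ hp.1 _ hq.2)
    convert this using 1
    simp only [Prod.fst_mul, Prod.snd_mul, map_mul]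
    noncomm_ring⟩
  smul_mem' c p hp := ⟨SMulMemClass.smul_mem c hp.1, by
    simpa [smul_sub] using SMulMemClass.smul_mem c hp.2⟩
  star_mem' {p} hp := ⟨star_mem hp.1, by simpa [map_star] using star_mem hp.2⟩

theorem NonUnitalStarAlgHom.isClosed_graphMod (ρ : 𝔄 →⋆ₙₐ[ℂ] 𝔅)
    {D : NonUnitalStarSubalgebra ℂ 𝔄} {I : NonUnitalStarSubalgebra ℂ 𝔅}
    (hD : IsClosed (D : Set 𝔄)) (hI : IsClosed (I : Set 𝔅))
    (h : ∀ d ∈ D, ∀ x ∈ I, ρ d * x ∈ I) : IsClosed (ρ.graphMod D I h : Set (𝔅 × 𝔄)) := by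
  have hρ : Continuous ρ := map_continuous ρ
  exact (hD.preimage continuous_snd).inter
    (hI.preimage (continuous_fst.sub (hρ.comp continuous_snd)))

theorem NonUnitalStarAlgHom.exists_norm_sub_le (ρ : 𝔄 →⋆ₙₐ[ℂ] 𝔅)
    {D : NonUnitalStarSubalgebra ℂ 𝔄} {I : NonUnitalStarSubalgebra ℂ 𝔅}
    (hD : IsClosed (D : Set 𝔄)) (hI : IsClosed (I : Set 𝔅))
    (h : ∀ d ∈ D, ∀ x ∈ I, ρ d * x ∈ I) {a : 𝔄} (ha : a ∈ D) {x : 𝔅} (hx : x ∈ I) :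
    ∃ d ∈ D, ρ d ∈ I ∧ ‖a - d‖ ≤ 2 * ‖ρ a + x‖ := by
  have := ρ.isClosed_graphMod hD hI h
  let φ : ρ.graphMod D I h →⋆ₙₐ[ℂ] 𝔅 :=
    (NonUnitalStarAlgHom.fst ℂ 𝔅 𝔄).comp (NonUnitalStarSubalgebraClass.subtype _)
  obtain ⟨⟨⟨y, a'⟩, ha', hy⟩, h1, h2⟩ :=
    φ.exists_norm_le_two_mul ⟨(ρ a + x, a), ha, by simpa using hx⟩
  change y = ρ a + x at h1
  subst h1
  refine ⟨a - a', sub_mem ha ha', ?_, ?_⟩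
  · have := sub_mem hy hx
    rw [map_sub]
    convert this using 1
    simp only
    abel
  · rw [sub_sub_cancel]
    exact (norm_snd_le (ρ a + x, a')).trans h2

theorem NonUnitalStarSubalgebra.norm_le_two_mul_norm_add {D I : NonUnitalStarSubalgebra ℂ 𝔄}
    (hD : IsClosed (D : Set 𝔄)) (hI : IsClosed (I : Set 𝔄)) (h : ∀ d ∈ D, ∀ x ∈ I, d * x ∈ I)
    (hDI : ∀ x ∈ D, x ∈ I → x = 0) {a x : 𝔄} (ha : a ∈ D) (hx : x ∈ I) :
    ‖a‖ ≤ 2 * ‖a + x‖ := by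
  obtain ⟨d, hd, hd', hn⟩ := (NonUnitalStarAlgHom.id ℂ 𝔄).exists_norm_sub_le hD hI h ha hx
  rw [hDI d hd hd', sub_zero] at hn
  exact hn

theorem NonUnitalStarSubalgebra.isClosed_sup_toSubmodule {D I : NonUnitalStarSubalgebra ℂ 𝔄}
    (hD : IsClosed (D : Set 𝔄)) (hI : IsClosed (I : Set 𝔄)) (h : ∀ d ∈ D, ∀ x ∈ I, d * x ∈ I)
    (hDI : ∀ x ∈ D, x ∈ I → x = 0) :
    IsClosed ((D.toSubmodule ⊔ I.toSubmodule : Submodule ℂ 𝔄) : Set 𝔄) := by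
  have := hD.completeSpace_coe
  have := hI.completeSpace_coe
  let f : D × I →+ 𝔄 := (AddSubmonoidClass.subtype D).coprod (AddSubmonoidClass.subtype I)
  have hf : AntilipschitzWith 3 f := AddMonoidHomClass.antilipschitz_of_bound f fun p ↦ by
    have h1 : ‖(p.1 : 𝔄)‖ ≤ 2 * ‖f p‖ := norm_le_two_mul_norm_add hD hI h hDI p.1.2 p.2.2
    have h2 : ‖(p.2 : 𝔄)‖ ≤ ‖f p‖ + ‖(p.1 : 𝔄)‖ := by
      have : (p.2 : 𝔄) = f p - p.1 := by simp [f]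
      rw [this]; exact norm_sub_le _ _
    have := norm_nonneg (f p)
    refine max_le ?_ ?_
    · change ‖(p.1 : 𝔄)‖ ≤ _; push_cast; linarith
    · change ‖(p.2 : 𝔄)‖ ≤ _; push_cast; linarith
  have hfc : UniformContinuous f :=
    (uniformContinuous_subtype_val.comp uniformContinuous_fst).add
      (uniformContinuous_subtype_val.comp uniformContinuous_snd)
  convert hf.isClosed_range hfc
  ext x
  simp only [SetLike.mem_coe, Submodule.mem_sup]
  constructor
  · rintro ⟨d, hd, y, hy, rfl⟩
    exact ⟨(⟨d, hd⟩, ⟨y, hy⟩), rfl⟩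
  · rintro ⟨p, rfl⟩
    exact ⟨p.1, p.1.2, p.2, p.2.2, rfl⟩

end CStarLift

section Grading

open scoped CStarAlgebra

variable {𝓛 : Type*} {𝔄 𝔅 : Type*}
  [NonUnitalCStarAlgebra 𝔄] [NonUnitalCStarAlgebra 𝔅]

/-- The sum of the components indexed by a finite set, as a submodule. -/
def finsetSum (A : 𝓛 → NonUnitalStarSubalgebra ℂ 𝔄) (F : Finset 𝓛) : Submodule ℂ 𝔄 :=
  ⨆ i ∈ F, (A i).toSubmodule

theorem mem_finsetSum {A : 𝓛 → NonUnitalStarSubalgebra ℂ 𝔄} {F : Finset 𝓛} {x : 𝔄} :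
    x ∈ finsetSum A F ↔ ∃ f : 𝓛 → 𝔄, (∀ i, f i ∈ A i) ∧ ∑ i ∈ F, f i = x := by
  rw [finsetSum, Submodule.mem_iSup_finset_iff_exists_sum]
  exact ⟨fun ⟨μ, h⟩ ↦ ⟨fun i ↦ μ i, fun i ↦ (μ i).2, h⟩,
    fun ⟨f, hf, h⟩ ↦ ⟨fun i ↦ ⟨f i, hf i⟩, h⟩⟩

theorem mem_finsetSum_of_mem {A : 𝓛 → NonUnitalStarSubalgebra ℂ 𝔄} {F : Finset 𝓛} {i : 𝓛}
    (hi : i ∈ F) {x : 𝔄} (hx : x ∈ A i) : x ∈ finsetSum A F :=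
  (le_iSup₂ (f := fun i (_ : i ∈ F) ↦ (A i).toSubmodule) i hi : _ ≤ finsetSum A F) hx

theorem eq_zero_of_mem_finsetSum_of_disjoint {A : 𝓛 → NonUnitalStarSubalgebra ℂ 𝔄}
    (hA_indep : ∀ (s : Finset 𝓛) (x : 𝓛 → 𝔄), (∀ i, x i ∈ A i) →
      ∑ i ∈ s, x i = 0 → ∀ i ∈ s, x i = 0)
    {F G : Finset 𝓛} (hFG : Disjoint F G) {x : 𝔄} (hF : x ∈ finsetSum A F)
    (hG : x ∈ finsetSum A G) : x = 0 := by
  classical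
  obtain ⟨f, hf, rfl⟩ := mem_finsetSum.mp hF
  obtain ⟨g, hg, hfg⟩ := mem_finsetSum.mp hG
  let u : 𝓛 → 𝔄 := fun i ↦ if i ∈ F then f i else -g i
  have huF : ∑ i ∈ F, u i = ∑ i ∈ F, f i := Finset.sum_congr rfl fun i hi ↦ if_pos hi
  have huG : ∑ i ∈ G, u i = -∑ i ∈ G, g i := by
    rw [← Finset.sum_neg_distrib]
    exact Finset.sum_congr rfl fun i hi ↦ if_neg (Finset.disjoint_right.mp hFG hi)
  have hu := hA_indep (F ∪ G) u
    (fun i ↦ by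
      by_cases hi : i ∈ F
      · simpa [u, hi] using hf i
      · simpa [u, hi] using hg i)
    (by rw [Finset.sum_union hFG, huF, huG, hfg, add_neg_cancel])
  rw [← huF]
  exact Finset.sum_eq_zero fun i hi ↦ hu i (Finset.mem_union_left _ hi)

theorem map_mem_finsetSum {A : 𝓛 → NonUnitalStarSubalgebra ℂ 𝔄}
    {B : 𝓛 → NonUnitalStarSubalgebra ℂ 𝔅} (ρ : 𝔄 →⋆ₙₐ[ℂ] 𝔅)
    (hρ : ∀ i : 𝓛, ∀ x ∈ A i, ρ x ∈ B i) {F : Finset 𝓛} {x : 𝔄}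
    (hx : x ∈ finsetSum A F) : ρ x ∈ finsetSum B F := by
  obtain ⟨f, hf, rfl⟩ := mem_finsetSum.mp hx
  rw [map_sum]
  exact mem_finsetSum.mpr ⟨fun i ↦ ρ (f i), fun i ↦ hρ i _ (hf i), rfl⟩

theorem surjective_of_forall_component_surjective {A : 𝓛 → NonUnitalStarSubalgebra ℂ 𝔄}
    {B : 𝓛 → NonUnitalStarSubalgebra ℂ 𝔅} (ρ : 𝔄 →⋆ₙₐ[ℂ] 𝔅)
    (hB_total : closure ((Submodule.span ℂ (⋃ i : 𝓛, (B i : Set 𝔅)) : Submodule ℂ 𝔅) : Set 𝔅) =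
      Set.univ)
    (h : ∀ i : 𝓛, ∀ y ∈ B i, ∃ x ∈ A i, ρ x = y) : Function.Surjective ρ := by
  rw [← Set.range_eq_univ, ← Set.univ_subset_iff, ← hB_total]
  refine closure_minimal ?_ ρ.isClosed_range_of_cstar
  have hle : Submodule.span ℂ (⋃ i : 𝓛, (B i : Set 𝔅)) ≤ LinearMap.range (ρ : 𝔄 →ₗ[ℂ] 𝔅) := by
    refine Submodule.span_le.mpr (Set.iUnion_subset fun i y hy ↦ ?_)
    obtain ⟨x, -, hx⟩ := h i y hy
    exact ⟨x, hx⟩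
  exact hle

variable [SemilatticeInf 𝓛]

theorem mul_mem_finsetSum {A : 𝓛 → NonUnitalStarSubalgebra ℂ 𝔄}
    (hA_mul : ∀ i j : 𝓛, ∀ x ∈ A i, ∀ y ∈ A j, x * y ∈ A (i ⊓ j)) {F G H : Finset 𝓛}
    (h : ∀ i ∈ F, ∀ j ∈ G, i ⊓ j ∈ H) {x y : 𝔄} (hx : x ∈ finsetSum A F)
    (hy : y ∈ finsetSum A G) : x * y ∈ finsetSum A H := by
  obtain ⟨f, hf, rfl⟩ := mem_finsetSum.mp hx
  obtain ⟨g, hg, rfl⟩ := mem_finsetSum.mp hy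
  rw [Finset.sum_mul_sum]
  exact sum_mem fun i hi ↦ sum_mem fun j hj ↦
    mem_finsetSum_of_mem (h i hi j hj) (hA_mul i j _ (hf i) _ (hg j))

/-- The sum of the components indexed by a finite subsemilattice, as a *-subalgebra. -/
def finsetSumSubalgebra (A : 𝓛 → NonUnitalStarSubalgebra ℂ 𝔄)
    (hA_mul : ∀ i j : 𝓛, ∀ x ∈ A i, ∀ y ∈ A j, x * y ∈ A (i ⊓ j)) (F : Finset 𝓛)
    (hF : ∀ i ∈ F, ∀ j ∈ F, i ⊓ j ∈ F) : NonUnitalStarSubalgebra ℂ 𝔄 where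
  __ := finsetSum A F
  mul_mem' := mul_mem_finsetSum hA_mul hF
  star_mem' {x} hx := by
    obtain ⟨f, hf, rfl⟩ := mem_finsetSum.mp hx
    rw [star_sum]
    exact mem_finsetSum.mpr ⟨fun i ↦ star (f i), fun i ↦ star_mem (hf i), rfl⟩

theorem isClosed_finsetSum {A : 𝓛 → NonUnitalStarSubalgebra ℂ 𝔄}
    (hA_closed : ∀ i : 𝓛, IsClosed ((A i : Set 𝔄)))
    (hA_indep : ∀ (s : Finset 𝓛) (x : 𝓛 → 𝔄), (∀ i, x i ∈ A i) →
      ∑ i ∈ s, x i = 0 → ∀ i ∈ s, x i = 0)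
    (hA_mul : ∀ i j : 𝓛, ∀ x ∈ A i, ∀ y ∈ A j, x * y ∈ A (i ⊓ j)) (F : Finset 𝓛)
    (hF : ∀ i ∈ F, ∀ j ∈ F, i ⊓ j ∈ F) : IsClosed (finsetSum A F : Set 𝔄) := by
  classical
  induction F using Finset.strongInduction with
  | H F ih =>
    obtain rfl | hne := F.eq_empty_or_nonempty
    · simp [finsetSum]
    obtain ⟨m, hm⟩ := F.exists_maximal hne
    have h_erase : ∀ i ∈ F, ∀ j ∈ F.erase m, i ⊓ j ∈ F.erase m := fun i hi j hj ↦ by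
      obtain ⟨hjm, hj⟩ := Finset.mem_erase.mp hj
      exact Finset.mem_erase.mpr
        ⟨fun h ↦ hjm (hm.eq_of_ge hj (h ▸ inf_le_right)), hF i hi j hj⟩
    have h_sub : ∀ i ∈ F.erase m, ∀ j ∈ F.erase m, i ⊓ j ∈ F.erase m :=
      fun i hi ↦ h_erase i (Finset.mem_of_mem_erase hi)
    have h_closed : IsClosed (finsetSumSubalgebra A hA_mul _ h_sub : Set 𝔄) :=
      ih _ (Finset.erase_ssubset hm.prop) h_sub
    have := NonUnitalStarSubalgebra.isClosed_sup_toSubmodule (hA_closed m) h_closed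
      (fun d hd x hx ↦ mul_mem_finsetSum hA_mul (F := {m})
        (by simpa using h_erase m hm.prop) (mem_finsetSum_of_mem (by simp) hd) hx)
      (fun x hx hx' ↦ eq_zero_of_mem_finsetSum_of_disjoint hA_indep (F := {m})
        (by simp) (mem_finsetSum_of_mem (by simp) hx) hx')
    convert this
    conv_lhs => rw [← Finset.insert_erase hm.prop, finsetSum, Finset.iSup_insert]
    rfl

theorem exists_mem_finsetSum_of_mem_span {A : 𝓛 → NonUnitalStarSubalgebra ℂ 𝔄} (i : 𝓛) {x : 𝔄}
    (hx : x ∈ Submodule.span ℂ (⋃ i : 𝓛, (A i : Set 𝔄))) :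
    ∃ F : Finset 𝓛, i ∈ F ∧ (∀ j ∈ F, ∀ k ∈ F, j ⊓ k ∈ F) ∧ x ∈ finsetSum A F := by
  classical
  suffices ∃ F : Finset 𝓛, x ∈ finsetSum A F by
    obtain ⟨F, hF⟩ := this
    have hfin : (infClosure (insert i F : Set 𝓛)).Finite :=
      (F.finite_toSet.insert i).infClosure
    refine ⟨hfin.toFinset, ?_, ?_, ?_⟩
    · simpa using subset_infClosure (Set.mem_insert i _)
    · simpa using fun j hj k hk ↦ infClosed_infClosure hj hk
    · obtain ⟨f, hf, rfl⟩ := mem_finsetSum.mp hF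
      refine sum_mem fun j hj ↦ mem_finsetSum_of_mem ?_ (hf j)
      simpa using subset_infClosure (Set.mem_insert_of_mem i hj)
  have mono {F G : Finset 𝓛} (h : F ⊆ G) : finsetSum A F ≤ finsetSum A G :=
    biSup_mono fun _ hi ↦ h hi
  induction hx using Submodule.span_induction with
  | mem x hx =>
    obtain ⟨j, hj⟩ := Set.mem_iUnion.mp hx
    exact ⟨{j}, mem_finsetSum_of_mem (by simp) hj⟩
  | zero => exact ⟨∅, zero_mem _⟩
  | add x y _ _ hx hy =>
    obtain ⟨F, hF⟩ := hx
    obtain ⟨G, hG⟩ := hy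
    exact ⟨F ∪ G, add_mem (mono Finset.subset_union_left hF) (mono Finset.subset_union_right hG)⟩
  | smul c x _ hx =>
    obtain ⟨F, hF⟩ := hx
    exact ⟨F, Submodule.smul_mem _ c hF⟩

variable {A : 𝓛 → NonUnitalStarSubalgebra ℂ 𝔄} {B : 𝓛 → NonUnitalStarSubalgebra ℂ 𝔅}
  (ρ : 𝔄 →⋆ₙₐ[ℂ] 𝔅)

theorem injective_of_forall_component_injective
    (hA_closed : ∀ i : 𝓛, IsClosed ((A i : Set 𝔄)))
    (hA_indep : ∀ (s : Finset 𝓛) (x : 𝓛 → 𝔄), (∀ i, x i ∈ A i) →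
      ∑ i ∈ s, x i = 0 → ∀ i ∈ s, x i = 0)
    (hA_total : closure ((Submodule.span ℂ (⋃ i : 𝓛, (A i : Set 𝔄)) : Submodule ℂ 𝔄) : Set 𝔄) =
      Set.univ)
    (hA_mul : ∀ i j : 𝓛, ∀ x ∈ A i, ∀ y ∈ A j, x * y ∈ A (i ⊓ j))
    (hB_indep : ∀ (s : Finset 𝓛) (x : 𝓛 → 𝔅), (∀ i, x i ∈ B i) →
      ∑ i ∈ s, x i = 0 → ∀ i ∈ s, x i = 0)
    (hρ : ∀ i : 𝓛, ∀ x ∈ A i, ρ x ∈ B i)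
    (h : ∀ i : 𝓛, ∀ x ∈ A i, ∀ y ∈ A i, ρ x = ρ y → x = y) : Function.Injective ρ := by
  have hρc : Continuous ρ := map_continuous ρ
  have bound (x : 𝔄) : ‖x‖ ≤ 2 * ‖ρ x‖ := by
    have hx : x ∈ closure
        ((Submodule.span ℂ (⋃ i : 𝓛, (A i : Set 𝔄)) : Submodule ℂ 𝔄) : Set 𝔄) :=
      hA_total ▸ Set.mem_univ x
    refine closure_minimal (t := {x | ‖x‖ ≤ 2 * ‖ρ x‖}) (fun a ha ↦ ?_)
      (isClosed_le continuous_norm (continuous_const.mul hρc.norm)) hx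
    obtain hempty | ⟨⟨i⟩⟩ := isEmpty_or_nonempty 𝓛
    · have : a = 0 := by simpa using ha
      simp [this]
    obtain ⟨F, -, hF, haF⟩ := exists_mem_finsetSum_of_mem_span i ha
    obtain ⟨d, hd, hd', hn⟩ := ρ.exists_norm_sub_le (D := finsetSumSubalgebra A hA_mul F hF)
      (I := ⊥) (isClosed_finsetSum hA_closed hA_indep hA_mul F hF)
      (by simp) (by simp [NonUnitalStarAlgebra.mem_bot]) haF
      (zero_mem _)
    obtain ⟨f, hf, rfl⟩ := mem_finsetSum.mp hd
    have hfz : ∑ j ∈ F, f j = 0 := by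
      refine Finset.sum_eq_zero fun j hj ↦ h j _ (hf j) 0 (zero_mem _) ?_
      rw [map_zero]
      refine hB_indep F (fun i ↦ ρ (f i)) (fun i ↦ hρ i _ (hf i)) ?_ j hj
      rw [← map_sum]
      exact NonUnitalStarAlgebra.mem_bot.mp hd'
    simpa [hfz] using hn
  rw [injective_iff_map_eq_zero]
  intro x hx
  simpa [hx] using bound x

theorem component_surjective_of_surjective
    (hA_closed : ∀ i : 𝓛, IsClosed ((A i : Set 𝔄)))
    (hA_indep : ∀ (s : Finset 𝓛) (x : 𝓛 → 𝔄), (∀ i, x i ∈ A i) →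
      ∑ i ∈ s, x i = 0 → ∀ i ∈ s, x i = 0)
    (hA_total : closure ((Submodule.span ℂ (⋃ i : 𝓛, (A i : Set 𝔄)) : Submodule ℂ 𝔄) : Set 𝔄) =
      Set.univ)
    (hA_mul : ∀ i j : 𝓛, ∀ x ∈ A i, ∀ y ∈ A j, x * y ∈ A (i ⊓ j))
    (hB_closed : ∀ i : 𝓛, IsClosed ((B i : Set 𝔅)))
    (hB_indep : ∀ (s : Finset 𝓛) (x : 𝓛 → 𝔅), (∀ i, x i ∈ B i) →
      ∑ i ∈ s, x i = 0 → ∀ i ∈ s, x i = 0)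
    (hB_mul : ∀ i j : 𝓛, ∀ x ∈ B i, ∀ y ∈ B j, x * y ∈ B (i ⊓ j))
    (hρ : ∀ i : 𝓛, ∀ x ∈ A i, ρ x ∈ B i) (hsurj : Function.Surjective ρ)
    (i : 𝓛) (b : 𝔅) (hb : b ∈ B i) : ∃ x ∈ A i, ρ x = b := by
  classical
  have hρc : Continuous ρ := map_continuous ρ
  have := hA_closed i
  suffices b ∈ closure (Set.range (ρ.comp (NonUnitalStarSubalgebraClass.subtype (A i)))) by
    rw [(NonUnitalStarAlgHom.isClosed_range_of_cstar _).closure_eq] at this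
    obtain ⟨x, hx⟩ := this
    exact ⟨x, x.2, hx⟩
  rw [Metric.mem_closure_iff]
  intro ε hε
  obtain ⟨a, rfl⟩ := hsurj b
  obtain ⟨c, hc, hcε⟩ : ∃ c ∈ Submodule.span ℂ (⋃ i : 𝓛, (A i : Set 𝔄)),
      ‖ρ c - ρ a‖ < ε / 6 := by
    have ha : a ∈ closure
        ((Submodule.span ℂ (⋃ i : 𝓛, (A i : Set 𝔄)) : Submodule ℂ 𝔄) : Set 𝔄) :=
      hA_total ▸ Set.mem_univ a
    obtain ⟨c, hc, h⟩ := Metric.mem_closure_iff.mp ha (ε / 6) (by positivity)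
    refine ⟨c, hc, ?_⟩
    rw [dist_comm, dist_eq_norm] at h
    rw [← map_sub]
    exact (NonUnitalStarAlgHom.norm_apply_le ρ _).trans_lt h
  obtain ⟨F, hiF, hF, hcF⟩ := exists_mem_finsetSum_of_mem_span i hc
  obtain ⟨f, hf, rfl⟩ := mem_finsetSum.mp hcF
  set G := F.filter (i ≤ ·) with hG_def
  set N := F.filter (¬ i ≤ ·) with hN_def
  have hG : ∀ j ∈ G, ∀ k ∈ G, j ⊓ k ∈ G := by
    simp only [hG_def, Finset.mem_filter]
    exact fun j hj k hk ↦ ⟨hF j hj.1 k hk.1, le_inf hj.2 hk.2⟩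
  have hFN : ∀ j ∈ F, ∀ k ∈ N, j ⊓ k ∈ N := by
    simp only [hN_def, Finset.mem_filter]
    exact fun j hj k hk ↦ ⟨hF j hj k hk.1, fun h ↦ hk.2 (h.trans inf_le_right)⟩
  have hGF : G ⊆ F := Finset.filter_subset _ _
  have hN : ∀ j ∈ N, ∀ k ∈ N, j ⊓ k ∈ N := fun j hj ↦ hFN j (Finset.filter_subset _ _ hj)
  have hGN : Disjoint G N := Finset.disjoint_filter_filter_not _ _ _
  have hiG : i ∈ G := by simp [hG_def, hiF]
  rw [← Finset.sum_filter_add_sum_filter_not F (i ≤ ·)] at hcε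
  set c₁ := ∑ j ∈ G, f j
  set c₂ := ∑ j ∈ N, f j
  have hc₁ : c₁ ∈ finsetSum A G := mem_finsetSum.mpr ⟨f, hf, rfl⟩
  have hc₂ : c₂ ∈ finsetSum A N := mem_finsetSum.mpr ⟨f, hf, rfl⟩
  have h₁ : ‖ρ c₁ - ρ a‖ ≤ 2 * ‖ρ c₁ - ρ a + ρ c₂‖ :=
    NonUnitalStarSubalgebra.norm_le_two_mul_norm_add
      (D := finsetSumSubalgebra B hB_mul G hG) (I := finsetSumSubalgebra B hB_mul N hN)
      (isClosed_finsetSum hB_closed hB_indep hB_mul G hG)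
      (isClosed_finsetSum hB_closed hB_indep hB_mul N hN)
      (fun d hd x hx ↦ mul_mem_finsetSum hB_mul (fun j hj ↦ hFN j (hGF hj)) hd hx)
      (fun x hx hx' ↦ eq_zero_of_mem_finsetSum_of_disjoint hB_indep hGN hx hx')
      (sub_mem (map_mem_finsetSum ρ hρ hc₁) (mem_finsetSum_of_mem hiG hb))
      (map_mem_finsetSum ρ hρ hc₂)
  obtain ⟨d, hd, hdB, h₂⟩ := ρ.exists_norm_sub_le (D := finsetSumSubalgebra A hA_mul G hG)
    (isClosed_finsetSum hA_closed hA_indep hA_mul G hG) (hB_closed i)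
    (fun d hd x hx ↦ by
      have := mul_mem_finsetSum hB_mul (H := {i})
        (fun j hj k hk ↦ by
          rw [Finset.mem_singleton] at hk ⊢
          rw [hk]
          exact inf_eq_right.mpr (Finset.mem_filter.mp hj).2)
        (map_mem_finsetSum ρ hρ hd) (mem_finsetSum_of_mem (Finset.mem_singleton_self i) hx)
      simpa [finsetSum] using this)
    hc₁ (neg_mem hb)
  obtain ⟨g, hg, rfl⟩ := mem_finsetSum.mp hd
  have hgi : ρ (∑ j ∈ G, g j) = ρ (g i) := by
    rw [← sub_eq_zero]
    refine eq_zero_of_mem_finsetSum_of_disjoint hB_indep (F := {i}) (G := G.erase i) (by simp)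
      (mem_finsetSum_of_mem (by simp) (sub_mem hdB (hρ i _ (hg i)))) ?_
    rw [← Finset.sum_erase_add _ _ hiG, map_add, add_sub_cancel_right]
    exact map_mem_finsetSum ρ hρ (mem_finsetSum.mpr ⟨g, hg, rfl⟩)
  refine ⟨_, ⟨⟨g i, hg i⟩, rfl⟩, ?_⟩
  change dist (ρ a) (ρ (g i)) < ε
  rw [← hgi, dist_comm, dist_eq_norm]
  have h₃ := NonUnitalStarAlgHom.norm_apply_le ρ (c₁ - ∑ j ∈ G, g j)
  have h₄ := norm_sub_le (ρ c₁ - ρ a) (ρ (c₁ - ∑ j ∈ G, g j))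
  rw [map_add, add_sub_right_comm] at hcε
  rw [← sub_eq_add_neg] at h₂
  rw [map_sub ρ c₁] at h₃ h₄
  rw [show ρ c₁ - ρ a - (ρ c₁ - ρ (∑ j ∈ G, g j)) = ρ (∑ j ∈ G, g j) - ρ a by abel] at h₄
  linarith

end Grading

theorem stmt_8
    {𝓛 : Type*} [SemilatticeInf 𝓛]
    {𝔄 : Type*} [NonUnitalNormedRing 𝔄] [StarRing 𝔄] [CStarRing 𝔄]
    [NormedSpace ℂ 𝔄] [IsScalarTower ℂ 𝔄 𝔄] [SMulCommClass ℂ 𝔄 𝔄]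
    [StarModule ℂ 𝔄] [CompleteSpace 𝔄]
    {𝔅 : Type*} [NonUnitalNormedRing 𝔅] [StarRing 𝔅] [CStarRing 𝔅]
    [NormedSpace ℂ 𝔅] [IsScalarTower ℂ 𝔅 𝔅] [SMulCommClass ℂ 𝔅 𝔅]
    [StarModule ℂ 𝔅] [CompleteSpace 𝔅]
    (A : 𝓛 → NonUnitalStarSubalgebra ℂ 𝔄)
    (hA_closed : ∀ i : 𝓛, IsClosed ((A i : Set 𝔄)))
    (hA_indep : ∀ (s : Finset 𝓛) (x : 𝓛 → 𝔄), (∀ i, x i ∈ A i) →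
        ∑ i ∈ s, x i = 0 → ∀ i ∈ s, x i = 0)
    (hA_total : closure ((Submodule.span ℂ (⋃ i : 𝓛, (A i : Set 𝔄)) : Submodule ℂ 𝔄) : Set 𝔄) = Set.univ)
    (hA_mul : ∀ i j : 𝓛, ∀ x ∈ A i, ∀ y ∈ A j, x * y ∈ A (i ⊓ j))
    (B : 𝓛 → NonUnitalStarSubalgebra ℂ 𝔅)
    (hB_closed : ∀ i : 𝓛, IsClosed ((B i : Set 𝔅)))
    (hB_indep : ∀ (s : Finset 𝓛) (x : 𝓛 → 𝔅), (∀ i, x i ∈ B i) →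
        ∑ i ∈ s, x i = 0 → ∀ i ∈ s, x i = 0)
    (hB_total : closure ((Submodule.span ℂ (⋃ i : 𝓛, (B i : Set 𝔅)) : Submodule ℂ 𝔅) : Set 𝔅) = Set.univ)
    (hB_mul : ∀ i j : 𝓛, ∀ x ∈ B i, ∀ y ∈ B j, x * y ∈ B (i ⊓ j))
    (ρ : 𝔄 →⋆ₙₐ[ℂ] 𝔅) (hρ : ∀ i : 𝓛, ∀ x ∈ A i, ρ x ∈ B i) :
    (Function.Surjective ρ ↔ ∀ i : 𝓛, ∀ y ∈ B i, ∃ x ∈ A i, ρ x = y) ∧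
    (Function.Injective ρ ↔ ∀ i : 𝓛, ∀ x ∈ A i, ∀ y ∈ A i, ρ x = ρ y → x = y) := by
  let _ : NonUnitalCStarAlgebra 𝔄 := { }
  let _ : NonUnitalCStarAlgebra 𝔅 := { }
  exact ⟨⟨component_surjective_of_surjective ρ hA_closed hA_indep hA_total hA_mul hB_closed
        hB_indep hB_mul hρ,
      surjective_of_forall_component_surjective ρ hB_total⟩,
    ⟨fun h _ _ _ _ _ hxy ↦ h hxy,
      injective_of_forall_component_injective ρ hA_closed hA_indep hA_total hA_mul hB_indep hρ⟩⟩
end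

section
/- Let (𝔄,(A_i)_{i∈𝓛}) be an 𝓛-graded C*-algebra. Assume that for all k, ℓ ∈ 𝓛 with k ≤ ℓ and k ≠ ℓ and every y ∈ A_ℓ, the following holds: if there exists z ∈ A_k with y·x = z·x and x·y = x·z for all x ∈ A_k, then y = 0. Then for every i ∈ 𝓛 and every a in the topological closure of 𝔄_{𝓛_i}, where 𝓛_i = {j ∈ 𝓛 : i ≤ j}: if a·x = 0 and x·a = 0 for all x ∈ A_i, then a = 0. -/
open scoped Pointwise

section CStarSum

variable {𝔄 : Type*} [NonUnitalCStarAlgebra 𝔄]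

/-- The pairs `(u, v)` with `v ∈ C` and `u - v ∈ I`; a star subalgebra when `I` absorbs products
with `C`. -/
def pairSubalgebra (C I : NonUnitalStarSubalgebra ℂ 𝔄)
    (h : ∀ c ∈ C, ∀ x ∈ I, c * x ∈ I ∧ x * c ∈ I) : NonUnitalStarSubalgebra ℂ (𝔄 × 𝔄) where
  carrier := {p | p.2 ∈ C ∧ p.1 - p.2 ∈ I}
  zero_mem' := ⟨zero_mem C, by simp⟩
  add_mem' {p q} hp hq := ⟨add_mem hp.1 hq.1, by
    have e : (p + q).1 - (p + q).2 = (p.1 - p.2) + (q.1 - q.2) := by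
      simp only [Prod.fst_add, Prod.snd_add]; abel
    rw [e]; exact add_mem hp.2 hq.2⟩
  mul_mem' {p q} hp hq := ⟨mul_mem hp.1 hq.1, by
    have e : (p * q).1 - (p * q).2 =
        (p.1 - p.2) * (q.1 - q.2) + (p.1 - p.2) * q.2 + p.2 * (q.1 - q.2) := by
      simp only [Prod.fst_mul, Prod.snd_mul]; noncomm_ring
    rw [e]
    exact add_mem (add_mem (mul_mem hp.2 hq.2) (h _ hq.1 _ hp.2).2) (h _ hp.1 _ hq.2).1⟩
  smul_mem' c p hp := ⟨SMulMemClass.smul_mem c hp.1, by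
    have e : (c • p).1 - (c • p).2 = c • (p.1 - p.2) := by simp [smul_sub]
    rw [e]; exact SMulMemClass.smul_mem c hp.2⟩
  star_mem' {p} hp := ⟨star_mem hp.1, by
    have e : (star p).1 - (star p).2 = star (p.1 - p.2) := by simp
    rw [e]; exact star_mem hp.2⟩

variable {C I : NonUnitalStarSubalgebra ℂ 𝔄}
  (h : ∀ c ∈ C, ∀ x ∈ I, c * x ∈ I ∧ x * c ∈ I)

theorem isClosed_pairSubalgebra (hC : IsClosed (C : Set 𝔄)) (hI : IsClosed (I : Set 𝔄)) :
    IsClosed (pairSubalgebra C I h : Set (𝔄 × 𝔄)) :=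
  (hC.preimage continuous_snd).inter (hI.preimage (continuous_fst.sub continuous_snd))

include h

theorem isometry_fst_pairSubalgebra (hC : IsClosed (C : Set 𝔄)) (hI : IsClosed (I : Set 𝔄))
    (hCI : ∀ x ∈ C, x ∈ I → x = 0) :
    Isometry fun p : pairSubalgebra C I h ↦ (p : 𝔄 × 𝔄).1 := by
  have : IsClosed (pairSubalgebra C I h : Set (𝔄 × 𝔄)) := isClosed_pairSubalgebra h hC hI
  let φ : pairSubalgebra C I h →⋆ₙₐ[ℂ] 𝔄 :=
    (NonUnitalStarAlgHom.fst ℂ 𝔄 𝔄).comp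
      (NonUnitalStarSubalgebraClass.subtype (pairSubalgebra C I h))
  have hφ : Function.Injective φ := by
    rw [injective_iff_map_eq_zero]
    rintro ⟨⟨u, v⟩, hv, huv⟩ h0
    have hu : u = 0 := h0
    subst hu
    have hvI : v ∈ I := by simpa using huv
    have := hCI v hv hvI
    subst this
    rfl
  exact NonUnitalStarAlgHom.isometry φ hφ

theorem norm_le_norm_add_of_disjoint (hC : IsClosed (C : Set 𝔄)) (hI : IsClosed (I : Set 𝔄))
    (hCI : ∀ x ∈ C, x ∈ I → x = 0) {y z : 𝔄} (hy : y ∈ C) (hz : z ∈ I) :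
    ‖y‖ ≤ ‖y + z‖ := by
  have hiso := isometry_fst_pairSubalgebra h hC hI hCI
  have hmem : (y + z, y) ∈ pairSubalgebra C I h := ⟨hy, by simpa using hz⟩
  have := hiso.dist_eq ⟨_, hmem⟩ ⟨0, zero_mem _⟩
  simp only [Subtype.dist_eq, dist_zero_right, Prod.fst_zero] at this
  rw [this]
  exact norm_snd_le (y + z, y)

theorem isClosed_add_of_disjoint (hC : IsClosed (C : Set 𝔄)) (hI : IsClosed (I : Set 𝔄))
    (hCI : ∀ x ∈ C, x ∈ I → x = 0) : IsClosed ((C : Set 𝔄) + (I : Set 𝔄)) := by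
  have : IsClosed (pairSubalgebra C I h : Set (𝔄 × 𝔄)) := isClosed_pairSubalgebra h hC hI
  have hiso := isometry_fst_pairSubalgebra h hC hI hCI
  have : CompleteSpace (pairSubalgebra C I h) := this.completeSpace_coe
  convert hiso.isClosedEmbedding.isClosed_range using 1
  ext x
  constructor
  · rintro ⟨y, hy, z, hz, rfl⟩
    exact ⟨⟨(y + z, y), hy, by simpa using hz⟩, rfl⟩
  · rintro ⟨⟨p, hp, hp'⟩, rfl⟩
    exact ⟨p.2, hp, p.1 - p.2, hp', by simp⟩

end CStarSum

section GradedSpan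

variable {𝓛 : Type*} {𝔄 : Type*} [NonUnitalCStarAlgebra 𝔄]

/-- The linear span of the components indexed by `M`. -/
def gradedSpan (A : 𝓛 → NonUnitalStarSubalgebra ℂ 𝔄) (M : Set 𝓛) : Submodule ℂ 𝔄 :=
  Submodule.span ℂ (⋃ j ∈ M, (A j : Set 𝔄))

variable {A : 𝓛 → NonUnitalStarSubalgebra ℂ 𝔄}

theorem mem_gradedSpan_of_mem {M : Set 𝓛} {j : 𝓛} (hj : j ∈ M) {x : 𝔄} (hx : x ∈ A j) :
    x ∈ gradedSpan A M :=
  Submodule.subset_span (Set.mem_biUnion hj hx)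

theorem gradedSpan_mono {M N : Set 𝓛} (h : M ⊆ N) : gradedSpan A M ≤ gradedSpan A N :=
  Submodule.span_mono (Set.biUnion_subset_biUnion_left h)

theorem star_mem_gradedSpan {M : Set 𝓛} {x : 𝔄} (hx : x ∈ gradedSpan A M) :
    star x ∈ gradedSpan A M := by
  induction hx using Submodule.span_induction with
  | mem x hx =>
    obtain ⟨j, hj, hx⟩ := Set.mem_iUnion₂.1 hx
    exact mem_gradedSpan_of_mem hj (star_mem (s := A j) hx)
  | zero => simp
  | add x y _ _ hx hy => simpa using add_mem hx hy
  | smul c x _ hx => simpa using Submodule.smul_mem _ _ hx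

theorem exists_finset_mem_gradedSpan {M : Set 𝓛} {x : 𝔄} (hx : x ∈ gradedSpan A M) :
    ∃ F : Finset 𝓛, (F : Set 𝓛) ⊆ M ∧ x ∈ gradedSpan A F := by
  classical
  induction hx using Submodule.span_induction with
  | mem x hx =>
    obtain ⟨j, hj, hx⟩ := Set.mem_iUnion₂.1 hx
    exact ⟨{j}, by simpa using hj, mem_gradedSpan_of_mem (by simp) hx⟩
  | zero => exact ⟨∅, by simp, zero_mem _⟩
  | add x y _ _ hx hy =>
    obtain ⟨F, hF, hx⟩ := hx
    obtain ⟨G, hG, hy⟩ := hy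
    refine ⟨F ∪ G, by simp [hF, hG], add_mem (gradedSpan_mono ?_ hx) (gradedSpan_mono ?_ hy)⟩ <;>
      simp
  | smul c x _ hx =>
    obtain ⟨F, hF, hx⟩ := hx
    exact ⟨F, hF, Submodule.smul_mem _ _ hx⟩

theorem exists_add_of_mem_gradedSpan_insert {M : Set 𝓛} {j : 𝓛} {x : 𝔄}
    (hx : x ∈ gradedSpan A (insert j M)) :
    ∃ y ∈ A j, ∃ z ∈ gradedSpan A M, y + z = x := by
  rw [gradedSpan, Set.biUnion_insert, Submodule.span_union, Submodule.mem_sup] at hx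
  obtain ⟨y, hy, z, hz, rfl⟩ := hx
  have hspan : Submodule.span ℂ (A j : Set 𝔄) = (A j).toNonUnitalSubalgebra.toSubmodule :=
    Submodule.span_eq (A j).toNonUnitalSubalgebra.toSubmodule
  rw [hspan] at hy
  exact ⟨y, hy, z, hz, rfl⟩

theorem exists_sum_of_mem_gradedSpan (F : Finset 𝓛) {x : 𝔄} (hx : x ∈ gradedSpan A F) :
    ∃ z : 𝓛 → 𝔄, (∀ i, z i ∈ A i) ∧ ∑ i ∈ F, z i = x := by
  classical
  induction F using Finset.induction_on generalizing x with
  | empty =>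
    have : x = 0 := by simpa [gradedSpan] using hx
    exact ⟨fun _ ↦ 0, fun i ↦ zero_mem (A i), by simp [this]⟩
  | insert j F hj ih =>
    rw [Finset.coe_insert] at hx
    obtain ⟨y, hy, w, hw, rfl⟩ := exists_add_of_mem_gradedSpan_insert hx
    obtain ⟨z, hz, rfl⟩ := ih hw
    refine ⟨Function.update z j y, fun i ↦ ?_, ?_⟩
    · by_cases hi : i = j
      · subst hi; simpa using hy
      · simpa [hi] using hz i
    · rw [Finset.sum_insert hj, Function.update_self,
        Finset.sum_congr rfl fun i hi ↦ Function.update_of_ne (ne_of_mem_of_not_mem hi hj) y z]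

/-- A component outside `F` is linearly disjoint from the components in `F`. -/
theorem eq_zero_of_add_mem_gradedSpan
    (hind : ∀ (s : Finset 𝓛) (x : 𝓛 → 𝔄), (∀ i, x i ∈ A i) →
      ∑ i ∈ s, x i = 0 → ∀ i ∈ s, x i = 0)
    {F : Finset 𝓛} {j : 𝓛} (hj : j ∉ F) {y z : 𝔄} (hy : y ∈ A j)
    (hz : z ∈ gradedSpan A F) (hyz : y + z = 0) : y = 0 := by
  classical
  obtain ⟨w, hw, rfl⟩ := exists_sum_of_mem_gradedSpan F hz
  have := hind (insert j F) (Function.update w j y) (fun i ↦ ?_) ?_ j (by simp)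
  · simpa using this
  · by_cases hi : i = j
    · subst hi; simpa using hy
    · simpa [hi] using hw i
  · rw [Finset.sum_insert hj, Function.update_self,
      Finset.sum_congr rfl fun i hi ↦ Function.update_of_ne (ne_of_mem_of_not_mem hi hj) y w, hyz]

variable [SemilatticeInf 𝓛] (hmul : ∀ i j : 𝓛, ∀ x ∈ A i, ∀ y ∈ A j, x * y ∈ A (i ⊓ j))

include hmul in
theorem mul_mem_gradedSpan {M N K : Set 𝓛} (hK : ∀ m ∈ M, ∀ n ∈ N, m ⊓ n ∈ K) {x y : 𝔄}
    (hx : x ∈ gradedSpan A M) (hy : y ∈ gradedSpan A N) : x * y ∈ gradedSpan A K := by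
  induction hx, hy using Submodule.span_induction₂ with
  | mem_mem x y hx hy =>
    obtain ⟨i, hi, hx⟩ := Set.mem_iUnion₂.1 hx
    obtain ⟨j, hj, hy⟩ := Set.mem_iUnion₂.1 hy
    exact mem_gradedSpan_of_mem (hK i hi j hj) (hmul i j x hx y hy)
  | zero_left => simp
  | zero_right => simp
  | add_left x y z _ _ _ hx hy => rw [add_mul]; exact add_mem hx hy
  | add_right x y z _ _ _ hx hy => rw [mul_add]; exact add_mem hx hy
  | smul_left r x y _ _ h => rw [smul_mul_assoc]; exact Submodule.smul_mem _ _ h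
  | smul_right r x y _ _ h => rw [mul_smul_comm]; exact Submodule.smul_mem _ _ h

/-- The span of the components over an inf-closed set, as a star subalgebra. -/
def gradedSubalgebra {M : Set 𝓛} (hM : InfClosed M) : NonUnitalStarSubalgebra ℂ 𝔄 where
  __ := gradedSpan A M
  mul_mem' hx hy := mul_mem_gradedSpan hmul (fun _ hm _ hn ↦ hM hm hn) hx hy
  star_mem' := star_mem_gradedSpan

theorem mem_gradedSubalgebra {M : Set 𝓛} (hM : InfClosed M) {x : 𝔄} :
    x ∈ gradedSubalgebra hmul hM ↔ x ∈ gradedSpan A M := Iff.rfl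

theorem infClosed_erase_of_maximal [DecidableEq 𝓛] {F : Finset 𝓛} (hF : InfClosed (F : Set 𝓛))
    {j : 𝓛} (hj : Maximal (· ∈ F) j) : InfClosed (F.erase j : Set 𝓛) := by
  intro a ha b hb
  simp only [Finset.coe_erase, Set.mem_sdiff, Finset.mem_coe, Set.mem_singleton_iff] at ha hb ⊢
  refine ⟨hF ha.1 hb.1, fun hab ↦ ha.2 ?_⟩
  have hja : j ≤ a := hab ▸ inf_le_left
  exact (hj.2 ha.1 hja).antisymm hja

include hmul in
theorem isClosed_gradedSpan (hcl : ∀ i, IsClosed (A i : Set 𝔄))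
    (hind : ∀ (s : Finset 𝓛) (x : 𝓛 → 𝔄), (∀ i, x i ∈ A i) →
      ∑ i ∈ s, x i = 0 → ∀ i ∈ s, x i = 0)
    (F : Finset 𝓛) (hF : InfClosed (F : Set 𝓛)) : IsClosed (gradedSpan A F : Set 𝔄) := by
  classical
  induction F using Finset.strongInduction with
  | H F ih =>
    rcases F.eq_empty_or_nonempty with rfl | hne
    · simp [gradedSpan]
    obtain ⟨j, hj⟩ := F.exists_maximal hne
    have hE := infClosed_erase_of_maximal hF hj
    have hEcl := ih _ (Finset.erase_ssubset hj.1) hE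
    have habs : ∀ k ∈ F.erase j, j ⊓ k ∈ F.erase j := fun k hk ↦ by
      rw [Finset.mem_erase] at hk ⊢
      refine ⟨fun e ↦ hk.1 ?_, hF hj.1 hk.2⟩
      have hjk : j ≤ k := inf_eq_left.1 e
      exact (hj.2 hk.2 hjk).antisymm hjk
    have hdis := isClosed_add_of_disjoint (C := A j) (I := gradedSubalgebra hmul hE)
      (fun c hc x hx ↦
        ⟨mul_mem_gradedSpan hmul (M := {j}) (N := F.erase j)
          (by rintro _ rfl n hn; exact habs n hn)
           (mem_gradedSpan_of_mem (Set.mem_singleton _) hc) hx,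
         mul_mem_gradedSpan hmul (M := F.erase j) (N := {j})
          (by rintro n hn _ rfl; rw [inf_comm]; exact habs n hn) hx
          (mem_gradedSpan_of_mem (Set.mem_singleton _) hc)⟩)
      (hcl j) hEcl
      (fun x hx hx' ↦ eq_zero_of_add_mem_gradedSpan hind (Finset.notMem_erase j F) hx
        (Submodule.neg_mem (gradedSpan A (F.erase j : Finset 𝓛))
          ((mem_gradedSubalgebra hmul hE).1 hx'))
        (add_neg_cancel x))
    convert hdis using 1
    ext x
    constructor
    · intro hx
      rw [← Finset.insert_erase hj.1, Finset.coe_insert] at hx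
      obtain ⟨y, hy, z, hz, rfl⟩ := exists_add_of_mem_gradedSpan_insert hx
      exact ⟨y, hy, z, hz, rfl⟩
    · rintro ⟨y, hy, z, hz, rfl⟩
      exact add_mem (mem_gradedSpan_of_mem hj.1 hy)
        (gradedSpan_mono (by simp) hz)

include hmul in
theorem eq_zero_of_annihilates (hind : ∀ (s : Finset 𝓛) (x : 𝓛 → 𝔄), (∀ i, x i ∈ A i) →
      ∑ i ∈ s, x i = 0 → ∀ i ∈ s, x i = 0)
    (hstruct : ∀ k ℓ : 𝓛, k ≤ ℓ → k ≠ ℓ → ∀ y ∈ A ℓ,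
      (∃ z ∈ A k, ∀ x ∈ A k, y * x = z * x ∧ x * y = x * z) → y = 0)
    {i : 𝓛} (F : Finset 𝓛) (hF : InfClosed (F : Set 𝓛)) (hi : i ∈ F) (hiF : ∀ k ∈ F, i ≤ k)
    {b : 𝔄} (hb : b ∈ gradedSpan A F) (hann : ∀ x ∈ A i, b * x = 0 ∧ x * b = 0) : b = 0 := by
  classical
  induction F using Finset.strongInduction generalizing b with
  | H F ih =>
    obtain ⟨j, hj⟩ := F.exists_maximal ⟨i, hi⟩
    have hE := infClosed_erase_of_maximal hF hj
    rw [← Finset.insert_erase hj.1, Finset.coe_insert] at hb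
    obtain ⟨y, hy, z, hz, rfl⟩ := exists_add_of_mem_gradedSpan_insert hb
    rcases eq_or_ne i j with rfl | hij
    · have hFi : F.erase i = ∅ := by
        ext k
        simp only [Finset.mem_erase, Finset.notMem_empty, iff_false, not_and]
        exact fun hk hkF ↦ hk ((hj.2 hkF (hiF k hkF)).antisymm (hiF k hkF))
      have hz0 : z = 0 := by simpa [gradedSpan, hFi] using hz
      subst hz0
      rw [add_zero] at hann ⊢
      exact CStarRing.mul_star_self_eq_zero_iff y |>.1 (hann _ (star_mem hy)).1
    have hiE : i ∈ F.erase j := Finset.mem_erase.2 ⟨hij, hi⟩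
    have hiE' : ∀ k ∈ F.erase j, i ≤ k := fun k hk ↦ hiF k (Finset.mem_of_mem_erase hk)
    have hlt : ∀ k ∈ F.erase j, j ⊓ k < j := fun k hk ↦ by
      rw [Finset.mem_erase] at hk
      refine inf_le_left.lt_of_ne fun e ↦ hk.1 ?_
      have hjk : j ≤ k := inf_eq_left.1 e
      exact (hj.2 hk.2 hjk).antisymm hjk
    have habs : ∀ m ∈ F, ∀ k ∈ F.erase j, m ⊓ k ∈ F.erase j := fun m hm k hk ↦ by
      rcases eq_or_ne m j with rfl | hmj
      · exact Finset.mem_erase.2 ⟨(hlt k hk).ne, hF hm (Finset.mem_of_mem_erase hk)⟩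
      · exact hE (Finset.mem_erase.2 ⟨hmj, hm⟩) hk
    have hbF : y + z ∈ gradedSpan A F := by
      rwa [← Finset.coe_insert, Finset.insert_erase hj.1] at hb
    have hmem_i : ∀ w ∈ gradedSpan A (F.erase j : Finset 𝓛), ∀ x ∈ A i,
        w * x ∈ A i ∧ x * w ∈ A i := by
      intro w hw x hx
      obtain ⟨g, hg, rfl⟩ := exists_sum_of_mem_gradedSpan _ hw
      rw [Finset.sum_mul, Finset.mul_sum]
      constructor
      · refine sum_mem fun k hk ↦ ?_
        have := hmul k i _ (hg k) x hx
        rwa [inf_eq_right.2 (hiE' k hk)] at this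
      · refine sum_mem fun k hk ↦ ?_
        have := hmul i k x hx _ (hg k)
        rwa [inf_eq_left.2 (hiE' k hk)] at this
    have hannE : ∀ w ∈ gradedSpan A (F.erase j : Finset 𝓛), (y + z) * w = 0 ∧ w * (y + z) = 0 := by
      intro w hw
      constructor
      · refine ih _ (Finset.erase_ssubset hj.1) hE hiE hiE'
          (mul_mem_gradedSpan hmul habs hbF hw) fun x hx ↦ ⟨?_, ?_⟩
        · rw [mul_assoc, (hann _ (hmem_i w hw x hx).1).1]
        · rw [← mul_assoc, (hann _ hx).2, zero_mul]
      · refine ih _ (Finset.erase_ssubset hj.1) hE hiE hiE'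
          (mul_mem_gradedSpan hmul (fun m hm n hn ↦ by rw [inf_comm]; exact habs n hn m hm)
            hw hbF) fun x hx ↦ ⟨?_, ?_⟩
        · rw [mul_assoc, (hann _ hx).1, mul_zero]
        · rw [← mul_assoc, (hann _ (hmem_i w hw x hx).2).2]
    have hy0 : y = 0 := by
      set G := F.filter (· < j) with hG
      obtain ⟨m, hm⟩ := G.exists_maximal ⟨i, by simp [hG, hi, (hiF j hj.1).lt_of_ne hij]⟩
      have hmF : m ∈ F := (Finset.mem_filter.1 hm.1).1
      have hmj : m < j := (Finset.mem_filter.1 hm.1).2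
      have hmE : m ∈ F.erase j := Finset.mem_erase.2 ⟨hmj.ne, hmF⟩
      set x := star y with hx
      have hxj : x ∈ A j := star_mem hy
      have hzx : z * x ∈ gradedSpan A G :=
        mul_mem_gradedSpan hmul (M := F.erase j) (N := {j})
          (by
            rintro k hk _ rfl
            rw [inf_comm]
            exact Finset.mem_filter.2
              ⟨hF hj.1 (Finset.mem_of_mem_erase hk), hlt k hk⟩) hz
          (mem_gradedSpan_of_mem (Set.mem_singleton _) hxj)
      rw [← Finset.insert_erase hm.1, Finset.coe_insert] at hzx
      obtain ⟨g, hg, r, hr, hgr⟩ := exists_add_of_mem_gradedSpan_insert hzx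
      have hlow : ∀ k ∈ G.erase m, k ⊓ m ∈ G.erase m := fun k hk ↦ by
        rw [Finset.mem_erase] at hk ⊢
        refine ⟨fun e ↦ hk.1 ?_, Finset.mem_filter.2
          ⟨hF (Finset.mem_filter.1 hk.2).1 hmF, inf_le_right.trans_lt hmj⟩⟩
        have hmk : m ≤ k := inf_eq_right.1 e
        exact (hm.2 hk.2 hmk).antisymm hmk
      have hym : ∀ w ∈ A m, y * x * w ∈ A m ∧ w * (y * x) ∈ A m := by
        intro w hw
        have hyx : y * x ∈ A j := mul_mem hy hxj
        constructor
        · have := hmul j m _ hyx w hw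
          rwa [inf_eq_right.2 hmj.le] at this
        · have := hmul m j w hw _ hyx
          rwa [inf_eq_left.2 hmj.le] at this
      have hyx0 : y * x = 0 := by
        refine hstruct m j hmj.le hmj.ne _ (mul_mem hy hxj) ⟨-g, neg_mem hg, fun w hw ↦ ?_⟩
        have hw' := mem_gradedSpan_of_mem (M := {m}) (Set.mem_singleton m) hw
        constructor
        · have hxw : x * w ∈ A m := by
            have := hmul j m x hxj w hw
            rwa [inf_eq_right.2 hmj.le] at this
          have h0 := (hannE (x * w) (mem_gradedSpan_of_mem hmE hxw)).1
          have h1 : (y * x * w + g * w) + r * w = 0 := by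
            rw [← h0, ← mul_assoc, add_mul y z x, ← hgr]
            simp only [add_mul, add_assoc]
          have h2 := eq_zero_of_add_mem_gradedSpan hind (Finset.notMem_erase m G)
            (add_mem (hym w hw).1 (mul_mem hg hw))
            (mul_mem_gradedSpan hmul (by rintro k hk _ rfl; exact hlow k hk) hr hw') h1
          rw [neg_mul]
          exact eq_neg_of_add_eq_zero_left h2
        · have h0 := (hannE w (mem_gradedSpan_of_mem hmE hw)).2
          have h1 : (w * (y * x) + w * g) + w * r = 0 := by
            rw [add_assoc, ← mul_add, hgr, ← mul_add, ← add_mul, ← mul_assoc, h0, zero_mul]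
          have h2 := eq_zero_of_add_mem_gradedSpan hind (Finset.notMem_erase m G)
            (add_mem (hym w hw).2 (mul_mem hw hg))
            (mul_mem_gradedSpan hmul
              (by rintro _ rfl k hk; rw [inf_comm]; exact hlow k hk) hw' hr) h1
          rw [mul_neg]
          exact eq_neg_of_add_eq_zero_left h2
      exact CStarRing.mul_star_self_eq_zero_iff y |>.1 hyx0
    subst hy0
    rw [zero_add] at hann ⊢
    exact ih _ (Finset.erase_ssubset hj.1) hE hiE hiE' hz hann

/-- The elements annihilating `B` on both sides. -/
def twoSidedAnnihilator (B : NonUnitalStarSubalgebra ℂ 𝔄) : NonUnitalStarSubalgebra ℂ 𝔄 where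
  carrier := {a | ∀ x ∈ B, a * x = 0 ∧ x * a = 0}
  zero_mem' := by simp
  add_mem' ha hb x hx := by simp [add_mul, mul_add, ha x hx, hb x hx]
  mul_mem' {a b} ha hb x hx := by
    rw [mul_assoc, (hb x hx).1, ← mul_assoc, (ha x hx).2]; simp
  smul_mem' c a ha x hx := by simp [smul_mul_assoc, mul_smul_comm, ha x hx]
  star_mem' {a} ha x hx := by
    have := ha (star x) (star_mem hx)
    constructor <;> apply star_injective <;> simp [this]

theorem mem_twoSidedAnnihilator {B : NonUnitalStarSubalgebra ℂ 𝔄} {a : 𝔄} :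
    a ∈ twoSidedAnnihilator B ↔ ∀ x ∈ B, a * x = 0 ∧ x * a = 0 := Iff.rfl

theorem isClosed_twoSidedAnnihilator (B : NonUnitalStarSubalgebra ℂ 𝔄) :
    IsClosed (twoSidedAnnihilator B : Set 𝔄) := by
  have : (twoSidedAnnihilator B : Set 𝔄) =
      ⋂ x ∈ B, {a | a * x = 0} ∩ {a | x * a = 0} := by
    ext a; simp [mem_twoSidedAnnihilator]
  rw [this]
  refine isClosed_biInter fun x _ ↦ ?_
  exact (isClosed_eq (by fun_prop) continuous_const).inter
    (isClosed_eq (by fun_prop) continuous_const)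

end GradedSpan

theorem stmt_10
    {𝓛 : Type*} [SemilatticeInf 𝓛]
    {𝔄 : Type*} [NonUnitalNormedRing 𝔄] [StarRing 𝔄] [CStarRing 𝔄]
    [NormedSpace ℂ 𝔄] [IsScalarTower ℂ 𝔄 𝔄] [SMulCommClass ℂ 𝔄 𝔄]
    [StarModule ℂ 𝔄] [CompleteSpace 𝔄]
    (A : 𝓛 → NonUnitalStarSubalgebra ℂ 𝔄)
    (hA_closed : ∀ i : 𝓛, IsClosed ((A i : Set 𝔄)))
    (hA_indep : ∀ (s : Finset 𝓛) (x : 𝓛 → 𝔄), (∀ i, x i ∈ A i) →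
        ∑ i ∈ s, x i = 0 → ∀ i ∈ s, x i = 0)
    (hA_total : closure ((Submodule.span ℂ (⋃ i : 𝓛, (A i : Set 𝔄)) : Submodule ℂ 𝔄) : Set 𝔄) = Set.univ)
    (hA_mul : ∀ i j : 𝓛, ∀ x ∈ A i, ∀ y ∈ A j, x * y ∈ A (i ⊓ j))
    (hstruct : ∀ k ℓ : 𝓛, k ≤ ℓ → k ≠ ℓ → ∀ y ∈ A ℓ,
        (∃ z ∈ A k, ∀ x ∈ A k, y * x = z * x ∧ x * y = x * z) → y = 0) :
    ∀ i : 𝓛, ∀ a ∈ closure ((Submodule.span ℂ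
        (⋃ j ∈ {j : 𝓛 | i ≤ j}, (A j : Set 𝔄)) : Submodule ℂ 𝔄) : Set 𝔄),
      (∀ x ∈ A i, a * x = 0 ∧ x * a = 0) → a = 0 := by
  classical
  let _ : NonUnitalCStarAlgebra 𝔄 := {}
  intro i a ha hann
  refine norm_le_zero_iff.1 (le_of_forall_pos_le_add fun ε hε ↦ ?_)
  obtain ⟨b, hb, hab⟩ := Metric.mem_closure_iff.1 ha (ε / 2) (half_pos hε)
  obtain ⟨F, hFi, hbF⟩ := exists_finset_mem_gradedSpan hb
  have hfin : (infClosure (insert i (F : Set 𝓛))).Finite :=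
    (F.finite_toSet.insert i).infClosure
  obtain ⟨G, hG⟩ := hfin.exists_finset_coe
  have hGinf : InfClosed (G : Set 𝓛) := hG ▸ infClosed_infClosure
  have hsub : insert i (F : Set 𝓛) ⊆ G := hG ▸ subset_infClosure
  have hiG : i ∈ G := hsub (Set.mem_insert _ _)
  have hGi : ∀ k ∈ G, i ≤ k := by
    have : (G : Set 𝓛) ⊆ Set.Ici i := by
      rw [hG]
      exact infClosure_min (Set.insert_subset le_rfl hFi) fun _ hx _ hy ↦ le_inf hx hy
    exact fun k hk ↦ this hk
  have hbG : b ∈ gradedSpan A G := gradedSpan_mono ((Set.subset_insert _ _).trans hsub) hbF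
  have habs : ∀ c ∈ gradedSpan A G, ∀ x ∈ A i, c * x ∈ A i ∧ x * c ∈ A i := by
    intro c hc x hx
    obtain ⟨g, hg, rfl⟩ := exists_sum_of_mem_gradedSpan _ hc
    rw [Finset.sum_mul, Finset.mul_sum]
    refine ⟨sum_mem fun k hk ↦ ?_, sum_mem fun k hk ↦ ?_⟩
    · simpa [inf_eq_right.2 (hGi k hk)] using hA_mul k i _ (hg k) x hx
    · simpa [inf_eq_left.2 (hGi k hk)] using hA_mul i k x hx _ (hg k)
  have key := norm_le_norm_add_of_disjoint (C := gradedSubalgebra hA_mul hGinf)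
    (I := twoSidedAnnihilator (A i))
    (fun c hc u hu ↦
      ⟨fun x hx ↦ ⟨by rw [mul_assoc, (hu x hx).1, mul_zero],
          by rw [← mul_assoc, (hu _ (habs c hc x hx).2).2]⟩,
        fun x hx ↦ ⟨by rw [mul_assoc, (hu _ (habs c hc x hx).1).1],
          by rw [← mul_assoc, (hu x hx).2, zero_mul]⟩⟩)
    (isClosed_gradedSpan hA_mul hA_closed hA_indep G hGinf) (isClosed_twoSidedAnnihilator _)
    (fun x hx hx0 ↦ eq_zero_of_annihilates hA_mul hA_indep hstruct G hGinf hiG hGi hx hx0)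
    hbG (neg_mem (s := twoSidedAnnihilator (A i)) hann)
  rw [← sub_eq_add_neg, ← dist_eq_norm, dist_comm] at key
  have htri : ‖a‖ ≤ ‖a - b‖ + ‖b‖ := by simpa using norm_add_le (a - b) b
  rw [← dist_eq_norm] at htri
  linarith
end

section
/- Let (𝔄,(A_i)_{i∈𝓛}) be an 𝓛-graded C*-algebra, where 𝓛 has a least element ℓ₀. Assume that for all k, ℓ ∈ 𝓛 with k ≤ ℓ and k ≠ ℓ and every y ∈ A_ℓ: if there exists z ∈ A_k with y·x = z·x and x·y = x·z for all x ∈ A_k, then y = 0. Then for every a ∈ 𝔄: if a·x = 0 and x·a = 0 for all x ∈ A_{ℓ₀}, then a = 0. -/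
open Finset in
/-- Sums of families valued in an independent family vanish componentwise. -/
theorem sum_filter_eq_zero_of_independent {ι κ M : Type*} [DecidableEq κ] [AddCommMonoid M]
    {S : Type*} [SetLike S M] [AddSubmonoidClass S M] {A : κ → S}
    (hA : ∀ (s : Finset κ) (x : κ → M), (∀ i, x i ∈ A i) → ∑ i ∈ s, x i = 0 → ∀ i ∈ s, x i = 0)
    (F : Finset ι) (g : ι → κ) (f : ι → M) (hf : ∀ i, f i ∈ A (g i))
    (hsum : ∑ i ∈ F, f i = 0) (j : κ) : ∑ i ∈ F with g i = j, f i = 0 := by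
  by_cases hj : j ∈ F.image g
  · refine hA (F.image g) (fun j => ∑ i ∈ F with g i = j, f i) (fun j => ?_) ?_ j hj
    · refine sum_mem fun i hi => ?_
      obtain ⟨-, rfl⟩ := mem_filter.mp hi
      exact hf i
    · rw [sum_fiberwise_of_maps_to fun i hi => mem_image_of_mem g hi, hsum]
  · rw [filter_eq_empty_iff.mpr, sum_empty]
    rintro i hi rfl
    exact hj (mem_image_of_mem g hi)

section CStar

variable {𝔄 : Type*} [NonUnitalCStarAlgebra 𝔄]

/-- The pairs `(x, y)` with `x ∈ B` and `y - x ∈ I`, for an ideal `I` normalized by `B`. -/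
def NonUnitalStarSubalgebra.congruencePairs (B I : NonUnitalStarSubalgebra ℂ 𝔄)
    (hBI : ∀ b ∈ B, ∀ x ∈ I, b * x ∈ I) : NonUnitalStarSubalgebra ℂ (𝔄 × 𝔄) where
  carrier := {p | p.1 ∈ B ∧ p.2 - p.1 ∈ I}
  zero_mem' := by simp [zero_mem]
  add_mem' {p q} hp hq := by
    refine ⟨add_mem hp.1 hq.1, ?_⟩
    simpa [add_sub_add_comm] using add_mem hp.2 hq.2
  smul_mem' c p hp := by
    refine ⟨SMulMemClass.smul_mem c hp.1, ?_⟩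
    simpa [smul_sub] using SMulMemClass.smul_mem c hp.2
  star_mem' {p} hp := by
    refine ⟨star_mem hp.1, ?_⟩
    simpa using star_mem hp.2
  mul_mem' {p q} hp hq := by
    refine ⟨mul_mem hp.1 hq.1, ?_⟩
    have hright : (p.2 - p.1) * q.1 ∈ I := by
      simpa using star_mem (hBI _ (star_mem hq.1) _ (star_mem hp.2))
    have h := add_mem (add_mem (mul_mem hp.2 hq.2) hright) (hBI _ hp.1 _ hq.2)
    convert h using 1
    simp only [Prod.snd_mul, Prod.fst_mul]
    noncomm_ring

/-- A closed star subalgebra `B` meeting an ideal `I` trivially embeds isometrically modulo `I`. -/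
theorem NonUnitalStarSubalgebra.norm_le_norm_add_of_disjoint (B I : NonUnitalStarSubalgebra ℂ 𝔄)
    (hB : IsClosed (B : Set 𝔄)) (hI : IsClosed (I : Set 𝔄))
    (hBI : ∀ b ∈ B, ∀ x ∈ I, b * x ∈ I) (hdisj : ∀ b ∈ B, b ∈ I → b = 0)
    {b x : 𝔄} (hb : b ∈ B) (hx : x ∈ I) : ‖b‖ ≤ ‖b + x‖ := by
  let D := B.congruencePairs I hBI
  have hD : IsClosed (D : Set (𝔄 × 𝔄)) :=
    (hB.preimage continuous_fst).inter (hI.preimage (continuous_snd.sub continuous_fst))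
  let φ : D →⋆ₙₐ[ℂ] 𝔄 :=
    (NonUnitalStarAlgHom.snd ℂ 𝔄 𝔄).comp (NonUnitalStarSubalgebraClass.subtype D)
  have hφ : Function.Injective φ := by
    refine (injective_iff_map_eq_zero φ).mpr ?_
    rintro ⟨⟨u, v⟩, hu, huv⟩ (rfl : v = 0)
    have : u = 0 := hdisj u hu (by simpa using huv)
    subst this
    rfl
  have hmem : (b, b + x) ∈ D := ⟨hb, by simpa using hx⟩
  have hnorm : ‖b + x‖ = ‖(b, b + x)‖ := NonUnitalStarAlgHom.norm_map φ hφ ⟨_, hmem⟩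
  rw [hnorm]
  exact norm_fst_le (b, b + x)

/-- The sum of a closed star subalgebra and a closed ideal meeting it trivially is closed. -/
theorem NonUnitalStarSubalgebra.isClosed_add_of_disjoint (B I : NonUnitalStarSubalgebra ℂ 𝔄)
    (hB : IsClosed (B : Set 𝔄)) (hI : IsClosed (I : Set 𝔄))
    (hBI : ∀ b ∈ B, ∀ x ∈ I, b * x ∈ I) (hdisj : ∀ b ∈ B, b ∈ I → b = 0) :
    IsClosed (Set.range fun p : B × I => (p.1 + p.2 : 𝔄)) := by
  have := hB.completeSpace_coe
  have := hI.completeSpace_coe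
  have hanti : AntilipschitzWith 2 fun p : B × I => (p.1 + p.2 : 𝔄) := by
    refine AntilipschitzWith.of_le_mul_dist fun p q => ?_
    have h := B.norm_le_norm_add_of_disjoint I hB hI hBI hdisj (p.1 - q.1).2 (p.2 - q.2).2
    have hsub : (p.1 + p.2 : 𝔄) - (q.1 + q.2) = (p.1 - q.1 : B) + (p.2 - q.2 : I) := by
      push_cast; abel
    rw [dist_eq_norm, dist_eq_norm, hsub]
    set y : 𝔄 := ((p.1 - q.1 : B) : 𝔄)
    set z : 𝔄 := ((p.2 - q.2 : I) : 𝔄)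
    have hz : ‖z‖ ≤ ‖y + z‖ + ‖y‖ := by simpa using norm_sub_le (y + z) y
    refine max_le (?_ : ‖y‖ ≤ 2 * ‖y + z‖) (?_ : ‖z‖ ≤ 2 * ‖y + z‖) <;>
      linarith [norm_nonneg (y + z)]
  refine hanti.isClosed_range ?_
  exact (uniformContinuous_subtype_val.comp uniformContinuous_fst).add
    (uniformContinuous_subtype_val.comp uniformContinuous_snd)

end CStar

theorem InfClosed.erase_of_maximal {𝓛 : Type*} [SemilatticeInf 𝓛] [DecidableEq 𝓛] {F : Finset 𝓛}
    (hF : InfClosed (F : Set 𝓛)) {m : 𝓛} (hm : Maximal (· ∈ F) m) :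
    InfClosed (F.erase m : Set 𝓛) := by
  intro i hi j hj
  simp only [Finset.coe_erase, Set.mem_sdiff, Finset.mem_coe, Set.mem_singleton_iff] at hi hj ⊢
  refine ⟨hF hi.1 hj.1, fun h => hi.2 ?_⟩
  exact hm.eq_of_ge hi.1 (h ▸ inf_le_left)

theorem InfClosed.image_inf_right {𝓛 : Type*} [SemilatticeInf 𝓛] [DecidableEq 𝓛] {F : Finset 𝓛}
    (hF : InfClosed (F : Set 𝓛)) (k : 𝓛) : InfClosed (F.image (· ⊓ k) : Set 𝓛) := by
  intro i hi j hj
  simp only [Finset.coe_image, Set.mem_image, Finset.mem_coe] at hi hj ⊢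
  obtain ⟨i, hi, rfl⟩ := hi
  obtain ⟨j, hj, rfl⟩ := hj
  exact ⟨i ⊓ j, hF hi hj, inf_inf_distrib_right i j k⟩

section Graded

variable {𝓛 : Type*} [SemilatticeInf 𝓛] {𝔄 : Type*} [NonUnitalCStarAlgebra 𝔄]
  {A : 𝓛 → NonUnitalStarSubalgebra ℂ 𝔄}

/-- The sum of the components of a graded algebra indexed by a finite inf-closed set. -/
def gradedPart (A : 𝓛 → NonUnitalStarSubalgebra ℂ 𝔄)
    (hA_mul : ∀ i j : 𝓛, ∀ x ∈ A i, ∀ y ∈ A j, x * y ∈ A (i ⊓ j))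
    (F : Finset 𝓛) (hF : InfClosed (F : Set 𝓛)) : NonUnitalStarSubalgebra ℂ 𝔄 where
  __ := ⨆ i ∈ F, (A i).toSubmodule
  star_mem' {a} ha := by
    obtain ⟨x, rfl⟩ := (Submodule.mem_iSup_finset_iff_exists_sum _ a).mp ha
    refine (Submodule.mem_iSup_finset_iff_exists_sum _ _).mpr
      ⟨fun i => ⟨star (x i : 𝔄), star_mem (s := A i) (x i).2⟩, ?_⟩
    simp [star_sum]
  mul_mem' {a b} ha hb := by
    obtain ⟨x, rfl⟩ := (Submodule.mem_iSup_finset_iff_exists_sum _ a).mp ha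
    obtain ⟨y, rfl⟩ := (Submodule.mem_iSup_finset_iff_exists_sum _ b).mp hb
    rw [Finset.sum_mul_sum]
    refine Submodule.sum_mem _ fun i hi => Submodule.sum_mem _ fun j hj => ?_
    exact Submodule.mem_iSup_of_mem (i ⊓ j) (Submodule.mem_iSup_of_mem (hF hi hj)
      (hA_mul i j _ (x i).2 _ (y j).2))

variable {hA_mul : ∀ i j : 𝓛, ∀ x ∈ A i, ∀ y ∈ A j, x * y ∈ A (i ⊓ j)}

theorem mem_gradedPart {F : Finset 𝓛} {hF : InfClosed (F : Set 𝓛)} {a : 𝔄} :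
    a ∈ gradedPart A hA_mul F hF ↔ ∃ x : 𝓛 → 𝔄, (∀ i, x i ∈ A i) ∧ ∑ i ∈ F, x i = a :=
  (Submodule.mem_iSup_finset_iff_exists_sum _ a).trans
    ⟨fun ⟨x, hx⟩ => ⟨fun i => x i, fun i => (x i).2, hx⟩,
      fun ⟨x, hx, h⟩ => ⟨fun i => ⟨x i, hx i⟩, h⟩⟩

theorem isClosed_gradedPart (hA_closed : ∀ i : 𝓛, IsClosed (A i : Set 𝔄))
    (hA_indep : ∀ (s : Finset 𝓛) (x : 𝓛 → 𝔄), (∀ i, x i ∈ A i) →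
        ∑ i ∈ s, x i = 0 → ∀ i ∈ s, x i = 0)
    (F : Finset 𝓛) (hF : InfClosed (F : Set 𝓛)) :
    IsClosed (gradedPart A hA_mul F hF : Set 𝔄) := by
  classical
  induction F using Finset.strongInduction with
  | H F ih =>
    rcases F.eq_empty_or_nonempty with rfl | hne
    · convert (isClosed_singleton : IsClosed {(0 : 𝔄)})
      ext a
      simp only [SetLike.mem_coe, mem_gradedPart, Finset.sum_empty, Set.mem_singleton_iff]
      exact ⟨fun ⟨_, _, h⟩ => h.symm, fun h => ⟨0, fun i => zero_mem (A i), h.symm⟩⟩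
    · obtain ⟨m, hm⟩ := F.exists_maximal hne
      have hF' := hF.erase_of_maximal hm
      have hcl := (A m).isClosed_add_of_disjoint (gradedPart A hA_mul (F.erase m) hF')
        (hA_closed m) (ih _ (Finset.erase_ssubset hm.1) hF') ?_ ?_
      · convert hcl
        ext a
        simp only [SetLike.mem_coe, mem_gradedPart, Set.mem_range, Prod.exists, Subtype.exists]
        constructor
        · rintro ⟨x, hx, rfl⟩
          exact ⟨x m, hx m, _, ⟨x, hx, rfl⟩, Finset.add_sum_erase F x hm.1⟩
        · rintro ⟨b, hb, _, ⟨x, hx, rfl⟩, rfl⟩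
          refine ⟨Function.update x m b, fun i => ?_, ?_⟩
          · rcases eq_or_ne i m with rfl | h <;> simp [*]
          · rw [← Finset.add_sum_erase F _ hm.1, Function.update_self]
            congr 1
            exact Finset.sum_congr rfl fun i hi =>
              Function.update_of_ne (Finset.ne_of_mem_erase hi) _ _
      · intro b hb a ha
        obtain ⟨x, hx, rfl⟩ := mem_gradedPart.mp ha
        rw [Finset.mul_sum]
        refine sum_mem fun i hi => ?_
        obtain ⟨him, hi⟩ := Finset.mem_erase.mp hi
        have hmem : m ⊓ i ∈ F.erase m :=
          Finset.mem_erase.mpr ⟨fun h => him (hm.eq_of_ge hi (h ▸ inf_le_right)), hF hm.1 hi⟩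
        exact Submodule.mem_iSup_of_mem (m ⊓ i) (Submodule.mem_iSup_of_mem hmem
          (hA_mul m i b hb _ (hx i)))
      · intro b hb hb'
        obtain ⟨x, hx, rfl⟩ := mem_gradedPart.mp hb'
        have h := hA_indep F (Function.update x m (-∑ i ∈ F.erase m, x i)) (fun i => ?_) ?_ m hm.1
        · simpa using h
        · rcases eq_or_ne i m with rfl | h
          · simpa using hb
          · simp [*]
        · rw [← Finset.add_sum_erase F _ hm.1, Function.update_self, neg_add_eq_zero]
          exact Finset.sum_congr rfl fun i hi =>
            (Function.update_of_ne (Finset.ne_of_mem_erase hi) _ _).symm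

/-- The two-sided annihilator of a star subalgebra. -/
def annihilator (I : NonUnitalStarSubalgebra ℂ 𝔄) : NonUnitalStarSubalgebra ℂ 𝔄 where
  carrier := {a | ∀ x ∈ I, a * x = 0 ∧ x * a = 0}
  zero_mem' := by simp
  add_mem' ha hb x hx := by
    simp [add_mul, mul_add, (ha x hx).1, (ha x hx).2, (hb x hx).1, (hb x hx).2]
  smul_mem' c a ha x hx := by simp [smul_mul_assoc, mul_smul_comm, (ha x hx).1, (ha x hx).2]
  mul_mem' {a b} ha hb x hx := by
    simp [mul_assoc, (hb x hx).1, ← mul_assoc x, (ha x hx).2]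
  star_mem' {a} ha x hx := by
    have h := ha (star x) (star_mem hx)
    constructor <;> apply star_injective <;> simp [h.1, h.2]

theorem isClosed_annihilator (I : NonUnitalStarSubalgebra ℂ 𝔄) :
    IsClosed (annihilator I : Set 𝔄) := by
  have h : (annihilator I : Set 𝔄) = ⋂ x ∈ I, {a | a * x = 0 ∧ x * a = 0} := by
    ext a
    simp only [Set.mem_iInter]
    rfl
  rw [h]
  exact isClosed_biInter fun x _ =>
    (isClosed_eq (continuous_mul_const x) continuous_const).inter
      (isClosed_eq (continuous_const_mul x) continuous_const)

/-- A finite sum of homogeneous elements annihilating the least component vanishes. -/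
theorem eq_zero_of_mem_gradedPart_of_annihilates
    (hA_indep : ∀ (s : Finset 𝓛) (x : 𝓛 → 𝔄), (∀ i, x i ∈ A i) →
        ∑ i ∈ s, x i = 0 → ∀ i ∈ s, x i = 0)
    (hA_mul : ∀ i j : 𝓛, ∀ x ∈ A i, ∀ y ∈ A j, x * y ∈ A (i ⊓ j))
    {ℓ₀ : 𝓛} (hℓ₀ : ∀ i : 𝓛, ℓ₀ ≤ i)
    (hstruct : ∀ k ℓ : 𝓛, k ≤ ℓ → k ≠ ℓ → ∀ y ∈ A ℓ,
        (∃ z ∈ A k, ∀ x ∈ A k, y * x = z * x ∧ x * y = x * z) → y = 0)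
    (F : Finset 𝓛) (hF : InfClosed (F : Set 𝓛)) (a : 𝔄)
    (ha : a ∈ gradedPart A hA_mul F hF) (hann : ∀ x ∈ A ℓ₀, a * x = 0 ∧ x * a = 0) :
    a = 0 := by
  classical
  induction F using Finset.strongInduction generalizing a with
  | H F ih =>
    obtain ⟨x, hx, rfl⟩ := mem_gradedPart.mp ha
    rcases F.eq_empty_or_nonempty with rfl | hne
    · simp
    obtain ⟨m, hm⟩ := F.exists_maximal hne
    have hF' := hF.erase_of_maximal hm
    suffices hxm : x m = 0 by
      have hsum : ∑ i ∈ F, x i = ∑ i ∈ F.erase m, x i := by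
        rw [← Finset.add_sum_erase F x hm.1, hxm, zero_add]
      rw [hsum] at hann ⊢
      exact ih _ (Finset.erase_ssubset hm.1) hF' _ (mem_gradedPart.mpr ⟨x, hx, rfl⟩) hann
    have hmul_zero : ∀ k, F.image (· ⊓ k) ⊂ F → ∀ y ∈ A k,
        ∑ i ∈ F with i ⊓ k = k, x i * y = 0 ∧ ∑ i ∈ F with i ⊓ k = k, y * x i = 0 := by
      intro k hk y hy
      have hFk := hF.image_inf_right k
      have hleft : ∀ i, x i * y ∈ A (i ⊓ k) := fun i => hA_mul i k _ (hx i) _ hy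
      have hright : ∀ i, y * x i ∈ A (i ⊓ k) := fun i => inf_comm i k ▸ hA_mul k i _ hy _ (hx i)
      have hmem : ∀ f : 𝓛 → 𝔄, (∀ i, f i ∈ A (i ⊓ k)) →
          ∑ i ∈ F, f i ∈ gradedPart A hA_mul (F.image (· ⊓ k)) hFk := fun f hf =>
        sum_mem fun i hi => Submodule.mem_iSup_of_mem (i ⊓ k)
          (Submodule.mem_iSup_of_mem (Finset.mem_image_of_mem _ hi) (hf i))
      have hy₀ : ∀ z ∈ A ℓ₀, y * z ∈ A ℓ₀ ∧ z * y ∈ A ℓ₀ := fun z hz =>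
        ⟨inf_eq_right.mpr (hℓ₀ k) ▸ hA_mul k ℓ₀ y hy z hz,
          inf_eq_left.mpr (hℓ₀ k) ▸ hA_mul ℓ₀ k z hz y hy⟩
      refine ⟨sum_filter_eq_zero_of_independent hA_indep F (· ⊓ k) _ hleft
        (ih _ hk hFk _ (hmem _ hleft) fun z hz => ?_) k,
        sum_filter_eq_zero_of_independent hA_indep F (· ⊓ k) _ hright
        (ih _ hk hFk _ (hmem _ hright) fun z hz => ?_) k⟩
      · rw [← Finset.sum_mul, mul_assoc, ← mul_assoc z]
        simp [hann _ (hy₀ z hz).1, hann z hz]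
      · rw [← Finset.mul_sum, mul_assoc, ← mul_assoc z]
        simp [hann _ (hy₀ z hz).2, hann z hz]
    have hsub : ∀ k ∈ F, F.image (· ⊓ k) ⊆ F := fun k hk => by
      simpa [Finset.image_subset_iff] using fun i hi => hF hi hk
    by_cases htop : ∀ i ∈ F, i ≤ m
    · rcases (F.erase m).eq_empty_or_nonempty with hempty | hne'
      · have hsum : ∑ i ∈ F, x i = x m := by
          rw [← Finset.add_sum_erase F x hm.1, hempty, Finset.sum_empty, add_zero]
        rw [hsum] at hann
        rcases eq_or_ne ℓ₀ m with rfl | hne₀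
        · exact CStarRing.mul_star_self_eq_zero_iff (x ℓ₀) |>.mp
            (hann _ (star_mem (hx _))).1
        · exact hstruct ℓ₀ m (hℓ₀ m) hne₀ _ (hx m) ⟨0, zero_mem _, by simpa using hann⟩
      · obtain ⟨k, hk⟩ := (F.erase m).exists_maximal hne'
        obtain ⟨hkm, hkF⟩ := Finset.mem_erase.mp hk.1
        have hlt : k < m := lt_of_le_of_ne (htop k hkF) hkm
        have hss : F.image (· ⊓ k) ⊂ F := by
          refine (Finset.ssubset_iff_of_subset (hsub k hkF)).mpr ⟨m, hm.1, fun h => ?_⟩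
          obtain ⟨i, -, hi⟩ := Finset.mem_image.mp h
          exact hlt.not_ge (hi ▸ inf_le_right)
        have hfilter : ({i ∈ F | i ⊓ k = k} : Finset 𝓛) = {m, k} := by
          ext i
          simp only [Finset.mem_filter, inf_eq_right, Finset.mem_insert, Finset.mem_singleton]
          constructor
          · rintro ⟨hi, hki⟩
            refine or_iff_not_imp_left.mpr fun him => ?_
            exact (hk.eq_of_le (Finset.mem_erase.mpr ⟨him, hi⟩) hki).symm
          · rintro (rfl | rfl)
            exacts [⟨hm.1, hlt.le⟩, ⟨hkF, le_rfl⟩]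
        refine hstruct k m hlt.le hkm _ (hx m) ⟨-x k, neg_mem (hx k), fun y hy => ?_⟩
        have h := hmul_zero k hss y hy
        rw [hfilter, Finset.sum_pair hkm.symm, Finset.sum_pair hkm.symm] at h
        rw [neg_mul, mul_neg]
        exact ⟨eq_neg_of_add_eq_zero_left h.1, eq_neg_of_add_eq_zero_left h.2⟩
    · push Not at htop
      obtain ⟨i, hiF, him⟩ := htop
      have hss : F.image (· ⊓ m) ⊂ F := by
        refine (Finset.ssubset_iff_of_subset (hsub m hm.1)).mpr ⟨i, hiF, fun h => him ?_⟩
        obtain ⟨j, -, rfl⟩ := Finset.mem_image.mp h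
        exact inf_le_right
      have hfilter : ({i ∈ F | i ⊓ m = m} : Finset 𝓛) = {m} := by
        ext i
        simp only [Finset.mem_filter, inf_eq_right, Finset.mem_singleton]
        exact ⟨fun h => (hm.eq_of_le h.1 h.2).symm, by rintro rfl; exact ⟨hm.1, le_rfl⟩⟩
      have h := (hmul_zero m hss _ (star_mem (hx m))).1
      rw [hfilter, Finset.sum_singleton] at h
      exact CStarRing.mul_star_self_eq_zero_iff (x m) |>.mp h

/-- Every algebraic sum of homogeneous elements lies in a finite graded part. -/
theorem exists_mem_gradedPart_of_mem_span {a : 𝔄}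
    (ha : a ∈ Submodule.span ℂ (⋃ i : 𝓛, (A i : Set 𝔄))) :
    ∃ (F : Finset 𝓛) (hF : InfClosed (F : Set 𝓛)), a ∈ gradedPart A hA_mul F hF := by
  have hsup : Submodule.span ℂ (⋃ i : 𝓛, (A i : Set 𝔄)) ≤ ⨆ i, (A i).toSubmodule :=
    Submodule.span_le.mpr (Set.iUnion_subset fun i => le_iSup (fun i => (A i).toSubmodule) i)
  obtain ⟨s, hs⟩ := Submodule.mem_iSup_iff_exists_finset.mp (hsup ha)
  have hfin : (infClosure (s : Set 𝓛)).Finite := s.finite_toSet.infClosure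
  have hcoe : (hfin.toFinset : Set 𝓛) = infClosure (s : Set 𝓛) := hfin.coe_toFinset
  refine ⟨hfin.toFinset, by rw [hcoe]; exact infClosed_infClosure, ?_⟩
  refine (biSup_mono fun i hi => ?_ : _ ≤ ⨆ i ∈ hfin.toFinset, (A i).toSubmodule) hs
  exact hfin.mem_toFinset.mpr (subset_infClosure hi)

end Graded


theorem stmt_11
    {𝓛 : Type*} [SemilatticeInf 𝓛]
    {𝔄 : Type*} [NonUnitalNormedRing 𝔄] [StarRing 𝔄] [CStarRing 𝔄]
    [NormedSpace ℂ 𝔄] [IsScalarTower ℂ 𝔄 𝔄] [SMulCommClass ℂ 𝔄 𝔄]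
    [StarModule ℂ 𝔄] [CompleteSpace 𝔄]
    (A : 𝓛 → NonUnitalStarSubalgebra ℂ 𝔄)
    (hA_closed : ∀ i : 𝓛, IsClosed ((A i : Set 𝔄)))
    (hA_indep : ∀ (s : Finset 𝓛) (x : 𝓛 → 𝔄), (∀ i, x i ∈ A i) →
        ∑ i ∈ s, x i = 0 → ∀ i ∈ s, x i = 0)
    (hA_total : closure ((Submodule.span ℂ (⋃ i : 𝓛, (A i : Set 𝔄)) : Submodule ℂ 𝔄) : Set 𝔄) = Set.univ)
    (hA_mul : ∀ i j : 𝓛, ∀ x ∈ A i, ∀ y ∈ A j, x * y ∈ A (i ⊓ j))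
    (ℓ₀ : 𝓛) (hℓ₀ : ∀ i : 𝓛, ℓ₀ ≤ i)
    (hstruct : ∀ k ℓ : 𝓛, k ≤ ℓ → k ≠ ℓ → ∀ y ∈ A ℓ,
        (∃ z ∈ A k, ∀ x ∈ A k, y * x = z * x ∧ x * y = x * z) → y = 0) :
    ∀ a : 𝔄, (∀ x ∈ A ℓ₀, a * x = 0 ∧ x * a = 0) → a = 0 := by
  let : NonUnitalCStarAlgebra 𝔄 := {}
  have hideal : ∀ a : 𝔄, ∀ x ∈ A ℓ₀, a * x ∈ A ℓ₀ := by
    intro a x hx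
    have hclosed : IsClosed {b : 𝔄 | b * x ∈ A ℓ₀} :=
      (hA_closed ℓ₀).preimage (continuous_mul_const x)
    refine closure_minimal ?_ hclosed (hA_total ▸ Set.mem_univ a)
    intro b hb
    induction hb using Submodule.span_induction with
    | mem b hb =>
      obtain ⟨i, hi⟩ := Set.mem_iUnion.mp hb
      exact inf_eq_right.mpr (hℓ₀ i) ▸ hA_mul i ℓ₀ b hi x hx
    | zero => simp [zero_mem]
    | add b c _ _ hb hc => simpa [add_mul] using add_mem hb hc
    | smul r b _ hb => simpa [smul_mul_assoc] using SMulMemClass.smul_mem r hb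
  intro a ha
  let J := annihilator (A ℓ₀)
  have hJ_closed : IsClosed (J : Set 𝔄) := isClosed_annihilator (A ℓ₀)
  have hJ : ∀ b : 𝔄, ∀ y ∈ J, b * y ∈ J := by
    intro b y hy x hx
    have hxb : x * b ∈ A ℓ₀ := by
      simpa using star_mem (hideal (star b) (star x) (star_mem hx))
    exact ⟨by rw [mul_assoc, (hy x hx).1, mul_zero], by rw [← mul_assoc, (hy _ hxb).2]⟩
  refine norm_le_zero_iff.mp (le_of_forall_pos_le_add fun ε hε => ?_)
  have hmem : a ∈ closure
      ((Submodule.span ℂ (⋃ i : 𝓛, (A i : Set 𝔄)) : Submodule ℂ 𝔄) : Set 𝔄) :=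
    hA_total ▸ Set.mem_univ a
  obtain ⟨b, hb, hab⟩ := Metric.mem_closure_iff.mp hmem (ε / 2) (half_pos hε)
  obtain ⟨F, hF, hbF⟩ := exists_mem_gradedPart_of_mem_span (hA_mul := hA_mul) hb
  have hle := (gradedPart A hA_mul F hF).norm_le_norm_add_of_disjoint J
    (isClosed_gradedPart hA_closed hA_indep F hF) hJ_closed (fun b _ => hJ b)
    (eq_zero_of_mem_gradedPart_of_annihilates hA_indep hA_mul hℓ₀ hstruct F hF)
    hbF (neg_mem (show a ∈ J from ha))
  rw [dist_eq_norm] at hab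
  rw [← sub_eq_add_neg, norm_sub_rev] at hle
  have htri : ‖a‖ ≤ ‖a - b‖ + ‖b‖ := by simpa using norm_add_le (a - b) b
  linarith
end
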